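/- arXiv:math/0603311 — 9 statements merged into one kernel-verified Lean document; each statement's English description precedes it below -/
import Mathlib

section
/- Structure Theorem for Value Disjunction: Let P = conv(F). Then P equals the set of all (x,w) ∈ ℝ^n × ℝ^d such that there exists y = (y^1,…,y^K) ∈ [0,1]^{n_1+⋯+n_K} with (y,w) ∈ Q and, for every i ∈ {1,…,K}, the pair (x restricted to N_i, y^i) lies in V_i. -/
/-- A point of a convex hull lying on a supporting hyperplane is a convex combination of
generators on that hyperplane. -/
theorem mem_convexHull_inter_of_le {E : Type*} [AddCommGroup E] [Module ℝ E] {S : Set E}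
    (l : E →ₗ[ℝ] ℝ) (c : ℝ) (hS : ∀ p ∈ S, l p ≤ c) {p : E} (hp : p ∈ convexHull ℝ S)
    (hc : l p = c) : p ∈ convexHull ℝ (S ∩ {q | l q = c}) := by
  have hsub : convexHull ℝ S ⊆
      {q | l q ≤ c ∧ (l q = c → q ∈ convexHull ℝ (S ∩ {q | l q = c}))} := by
    refine convexHull_min (fun q hq => ⟨hS q hq, fun h => subset_convexHull ℝ _ ⟨hq, h⟩⟩) ?_
    rintro q₁ ⟨h₁, h₁'⟩ q₂ ⟨h₂, h₂'⟩ s t hs ht hst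
    have hl : l (s • q₁ + t • q₂) = s * l q₁ + t * l q₂ := by simp
    refine ⟨?_, fun h => ?_⟩
    · rw [hl]
      calc s * l q₁ + t * l q₂ ≤ s * c + t * c := by gcongr
        _ = c := by rw [← add_mul, hst, one_mul]
    · rw [hl] at h
      rcases hs.eq_or_lt with rfl | hs'
      · obtain rfl : t = 1 := by linarith
        simpa using h₂' (by simpa using h)
      rcases ht.eq_or_lt with rfl | ht'
      · obtain rfl : s = 1 := by linarith
        simpa using h₁' (by simpa using h)
      have hsum : s * (c - l q₁) + t * (c - l q₂) = 0 := by
        have : (s + t) * c = c := by rw [hst, one_mul]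
        linarith
      have e₁ : 0 ≤ s * (c - l q₁) := mul_nonneg hs (by linarith)
      have e₂ : 0 ≤ t * (c - l q₂) := mul_nonneg ht (by linarith)
      have g₁ : c - l q₁ = 0 :=
        (mul_eq_zero.1 (by linarith : s * (c - l q₁) = 0)).resolve_left hs'.ne'
      have g₂ : c - l q₂ = 0 :=
        (mul_eq_zero.1 (by linarith : t * (c - l q₂) = 0)).resolve_left ht'.ne'
      exact convex_convexHull ℝ _ (h₁' (by linarith)) (h₂' (by linarith)) hs ht hst
  exact (hsub hp).2 hc

/-- The convex hull formulation of a disjunction: convex combinations of points of convex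
sets `C k`, together with their weights, form a convex set. -/
theorem convex_setOf_weighted_sum {ι E : Type*} [Fintype ι] [AddCommGroup E] [Module ℝ E]
    {C : ι → Set E} (hC : ∀ k, Convex ℝ (C k)) :
    Convex ℝ {q : E × (ι → ℝ) | (∀ k, 0 ≤ q.2 k) ∧ ∑ k, q.2 k = 1 ∧
      ∃ X : ι → E, (∀ k, X k ∈ C k) ∧ q.1 = ∑ k, q.2 k • X k} := by
  rintro ⟨x, y⟩ ⟨hy, hy1, X, hX, hx⟩ ⟨x', y'⟩ ⟨hy', hy1', X', hX', hx'⟩ s t hs ht hst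
  dsimp only at *
  have h := fun k => (hC k).exists_mem_add_smul_eq (hX k) (hX' k)
    (mul_nonneg hs (hy k)) (mul_nonneg ht (hy' k))
  choose Z hZ hZeq using h
  refine ⟨fun k => ?_, ?_, Z, hZ, ?_⟩
  · exact add_nonneg (mul_nonneg hs (hy k)) (mul_nonneg ht (hy' k))
  · simp [Finset.sum_add_distrib, ← Finset.mul_sum, hy1, hy1', hst]
  · simp [hZeq, hx, hx', Finset.sum_add_distrib, Finset.smul_sum, mul_smul]

/-- A `0/1` vector with coordinate sum `1` is a standard basis vector. -/
theorem exists_eq_single_of_sum_eq_one {ι : Type*} [Fintype ι] [DecidableEq ι] {y : ι → ℝ}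
    (hy : ∀ k, y k = 0 ∨ y k = 1) (hsum : ∑ k, y k = 1) : ∃ k, y = Pi.single k 1 := by
  have hnonneg : ∀ k, 0 ≤ y k := fun k => by rcases hy k with h | h <;> simp [h]
  obtain ⟨k, hk⟩ : ∃ k, y k = 1 := by
    by_contra! h
    have : ∑ k, y k = 0 := Finset.sum_eq_zero fun k _ => (hy k).resolve_right (h k)
    linarith
  refine ⟨k, funext fun k' => ?_⟩
  by_cases hkk : k' = k
  · subst hkk; simp [hk]
  · have hpair : ∑ i ∈ {k', k}, y i ≤ ∑ i, y i :=
      Finset.sum_le_sum_of_subset_of_nonneg (Finset.subset_univ _) fun i _ _ => hnonneg i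
    rw [Finset.sum_pair hkk, hk, hsum] at hpair
    simp only [Pi.single_eq_of_ne hkk]
    linarith [hnonneg k']

/-- A sum over a partitioned index set is the sum over the blocks. -/
theorem sum_eq_sum_blocks {ι κ : Type*} [Fintype ι] [Fintype κ] [DecidableEq ι]
    {N : κ → Finset ι} (hdisj : ∀ i i', i ≠ i' → Disjoint (N i) (N i'))
    (hcover : ∀ j, ∃ i, j ∈ N i) (h : ι → ℝ) : ∑ j, h j = ∑ i, ∑ j : N i, h j := by
  have huniv : (Finset.univ : Finset ι) = Finset.univ.biUnion N := by
    ext j; simpa using hcover j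
  rw [huniv, Finset.sum_biUnion fun i _ i' _ hne => hdisj i i' hne]
  exact Finset.sum_congr rfl fun i _ => (Finset.sum_coe_sort (N i) h).symm

/-- Structure Theorem for Value Disjunction.
`F ⊆ ℝ^n × ℝ^d` is the bounded mixed-integer set
`{(x,w) : x integral, 0 ≤ x ≤ u, w ≥ 0, ∑_j A_j x_j + ∑_j G_j w_j ≤ b}`.
The index set `{1,…,n}` is partitioned into nonempty blocks `N_1,…,N_K`; the
finite set `𝒜_i` of values `∑_{j∈N_i} A_j x_j` is enumerated (injectively and
exhaustively) as `f i 1, …, f i (n_i)`.  `V i` is the linking polyhedron and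
`Q` the aggregated polyhedron.  Then `P = conv F` equals the set of `(x,w)`
such that there exists `y ∈ [0,1]^{n_1+⋯+n_K}` with `(y,w) ∈ Q` and
`(x|_{N_i}, y^i) ∈ V_i` for each `i`. -/
theorem structure_theorem_for_value_disjunction
    (m n d K : ℕ) (hm : 0 < m) (hn : 0 < n) (hd : 0 < d) (hK : 0 < K)
    (A : Fin n → Fin m → ℝ) (G : Fin d → Fin m → ℝ) (b : Fin m → ℝ)
    (u : Fin n → ℤ) (hu : ∀ j, 0 ≤ u j)
    (N : Fin K → Finset (Fin n))
    (hNne : ∀ i, (N i).Nonempty)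
    (hNdisj : ∀ i i', i ≠ i' → Disjoint (N i) (N i'))
    (hNcover : ∀ j : Fin n, ∃ i, j ∈ N i)
    (ni : Fin K → ℕ)
    (f : (i : Fin K) → Fin (ni i) → Fin m → ℝ)
    (hfinj : ∀ i, Function.Injective (f i))
    (hfrange : ∀ i, Set.range (f i) =
      {v : Fin m → ℝ | ∃ x : Fin n → ℤ,
        (∀ j ∈ N i, 0 ≤ x j ∧ x j ≤ u j) ∧
        ∀ r, v r = ∑ j ∈ N i, (x j : ℝ) * A j r})
    (F : Set ((Fin n → ℝ) × (Fin d → ℝ)))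
    (hF : F = {p | (∀ j, ∃ z : ℤ, p.1 j = (z : ℝ) ∧ 0 ≤ z ∧ z ≤ u j) ∧
        (∀ j, 0 ≤ p.2 j) ∧
        ∀ r, (∑ j, p.1 j * A j r) + (∑ j, p.2 j * G j r) ≤ b r})
    (hFbdd : Bornology.IsBounded F)
    (V : (i : Fin K) → Set ((↥(N i) → ℝ) × (Fin (ni i) → ℝ)))
    (hV : ∀ i, V i = convexHull ℝ
      {q : (↥(N i) → ℝ) × (Fin (ni i) → ℝ) |
        (∀ j : ↥(N i), ∃ z : ℤ, q.1 j = (z : ℝ) ∧ 0 ≤ z ∧ z ≤ u j.1) ∧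
        (∀ k, q.2 k = 0 ∨ q.2 k = 1) ∧
        (∀ r, (∑ j : ↥(N i), q.1 j * A j.1 r) = ∑ k, q.2 k * f i k r) ∧
        (∑ k, q.2 k) = 1})
    (Q : Set (((i : Fin K) → Fin (ni i) → ℝ) × (Fin d → ℝ)))
    (hQ : Q = convexHull ℝ
      {q : ((i : Fin K) → Fin (ni i) → ℝ) × (Fin d → ℝ) |
        (∀ i k, q.1 i k = 0 ∨ q.1 i k = 1) ∧
        (∀ j, 0 ≤ q.2 j) ∧
        (∀ r, (∑ i, ∑ k, q.1 i k * f i k r) + (∑ j, q.2 j * G j r) ≤ b r) ∧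
        ∀ i, (∑ k, q.1 i k) ≤ 1}) :
    convexHull ℝ F =
      {p : (Fin n → ℝ) × (Fin d → ℝ) |
        ∃ y : (i : Fin K) → Fin (ni i) → ℝ,
          (∀ i k, 0 ≤ y i k ∧ y i k ≤ 1) ∧
          (y, p.2) ∈ Q ∧
          ∀ i, ((fun j : ↥(N i) => p.1 j.1), y i) ∈ V i} := by
  classical
  have hconv := convex_convexHull ℝ F
  apply Set.Subset.antisymm
  · refine convexHull_min ?_ ?_
    · rintro ⟨x, w⟩ hp
      rw [hF] at hp
      obtain ⟨hx, hw, hb⟩ := hp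
      dsimp only at hx hw hb
      choose z hz hz0 hzu using hx
      have hk : ∀ i, ∃ k, ∀ r, f i k r = ∑ j : N i, x j * A j r := by
        intro i
        have hmem : (fun r => ∑ j ∈ N i, (z j : ℝ) * A j r) ∈ Set.range (f i) := by
          rw [hfrange i]
          exact ⟨z, fun j _ => ⟨hz0 j, hzu j⟩, fun r => rfl⟩
        obtain ⟨k, hk⟩ := hmem
        refine ⟨k, fun r => ?_⟩
        rw [hk, Finset.sum_coe_sort (N i) fun j => x j * A j r]
        simp only [hz]
      choose k hk using hk
      have h01 : ∀ i k', (Pi.single (k i) 1 : Fin (ni i) → ℝ) k' = 0 ∨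
          (Pi.single (k i) 1 : Fin (ni i) → ℝ) k' = 1 := fun i k' => by
        by_cases h : k' = k i
        · subst h; simp
        · simp [h]
      have hval : ∀ i r, ∑ k', (Pi.single (k i) 1 : Fin (ni i) → ℝ) k' * f i k' r =
          ∑ j : N i, x j * A j r := fun i r => by
        rw [← hk]; simp [Pi.single_apply]
      refine ⟨fun i => Pi.single (k i) 1, fun i k' => ?_, ?_, fun i => ?_⟩
      · rcases h01 i k' with h | h <;> simp [h]
      · rw [hQ]
        refine subset_convexHull ℝ _ ⟨h01, hw, fun r => ?_, fun i => by simp⟩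
        simp only [hval]
        rw [← sum_eq_sum_blocks hNdisj hNcover fun j => x j * A j r]
        exact hb r
      · rw [hV]
        exact subset_convexHull ℝ _ ⟨fun j => ⟨z j, hz j, hz0 j, hzu j⟩, h01 i,
          fun r => (hval i r).symm, by simp⟩
    · rintro ⟨x, w⟩ ⟨y, hy, hyQ, hyV⟩ ⟨x', w'⟩ ⟨y', hy', hyQ', hyV'⟩ s t hs ht hst
      refine ⟨s • y + t • y', fun i k => ?_, ?_, fun i => ?_⟩
      · exact (convex_Icc (0 : ℝ) 1) (hy i k) (hy' i k) hs ht hst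
      · rw [hQ] at hyQ hyQ' ⊢
        exact convex_convexHull ℝ _ hyQ hyQ' hs ht hst
      · have h1 := hyV i
        have h2 := hyV' i
        rw [hV] at h1 h2 ⊢
        exact convex_convexHull ℝ _ h1 h2 hs ht hst
  · rintro ⟨x, w⟩ ⟨y, -, hyQ, hyV⟩
    dsimp only at hyQ hyV
    let S : (i : Fin K) → Fin (ni i) → Set (N i → ℝ) := fun i k =>
      {x | (∀ j : N i, ∃ z : ℤ, x j = (z : ℝ) ∧ 0 ≤ z ∧ z ≤ u j.1) ∧
        ∀ r, ∑ j : N i, x j * A j.1 r = f i k r}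
    have hSne : ∀ i k, (S i k).Nonempty := by
      intro i k
      have hmem : f i k ∈ Set.range (f i) := ⟨k, rfl⟩
      rw [hfrange i] at hmem
      obtain ⟨z, hz, hzf⟩ := hmem
      refine ⟨fun j => z j, fun j => ⟨z j, rfl, hz j j.2⟩, fun r => ?_⟩
      rw [hzf, Finset.sum_coe_sort (N i) fun j => (z j : ℝ) * A j r]
    have hdec : ∀ i, (∀ k, 0 ≤ y i k) ∧ ∑ k, y i k = 1 ∧
        ∃ X : Fin (ni i) → N i → ℝ, (∀ k, X k ∈ convexHull ℝ (S i k)) ∧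
          (fun j : N i => x j) = ∑ k, y i k • X k := by
      intro i
      have h := hyV i
      rw [hV] at h
      refine convexHull_min ?_ (convex_setOf_weighted_sum fun k => convex_convexHull ℝ (S i k)) h
      rintro ⟨x', y'⟩ ⟨hx', h01, hxy, hsum⟩
      dsimp only at hx' h01 hxy hsum
      obtain ⟨k, rfl⟩ := exists_eq_single_of_sum_eq_one h01 hsum
      have hx'S : x' ∈ S i k := ⟨hx', fun r => by rw [hxy]; simp [Pi.single_apply]⟩
      refine ⟨fun k' => ?_, hsum, fun k' => if k' = k then x' else (hSne i k').some,
        fun k' => ?_, ?_⟩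
      · rcases h01 k' with h | h <;> simp [h]
      · by_cases h : k' = k
        · subst h; simpa using subset_convexHull ℝ _ hx'S
        · simpa [h] using subset_convexHull ℝ _ (hSne i k').some_mem
      · dsimp only
        rw [Finset.sum_eq_single k (fun k' _ h => by simp [h]) (by simp)]
        simp
    choose _ hsum X hX hxX using hdec
    choose blk hblk using hNcover
    let Φ : ((i : Fin K) → N i → ℝ) → Fin n → ℝ := fun g j => g (blk j) ⟨j, hblk j⟩
    have hΦ : ∀ g i (j : N i), Φ g j = g i j := by
      rintro g i ⟨j, hj⟩
      have hi : blk j = i := by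
        by_contra hne
        exact Finset.disjoint_left.1 (hNdisj _ _ hne) (hblk j) hj
      subst hi
      rfl
    let l : (((i : Fin K) → Fin (ni i) → ℝ) × (Fin d → ℝ)) →ₗ[ℝ] ℝ :=
      { toFun := fun q => ∑ i, ∑ k, q.1 i k
        map_add' := fun p q => by simp [Finset.sum_add_distrib]
        map_smul' := fun c q => by simp [Finset.mul_sum] }
    rw [hQ] at hyQ
    have hface := mem_convexHull_inter_of_le l (∑ _i : Fin K, 1)
      (fun q hq => show ∑ i, ∑ k, q.1 i k ≤ _ from Finset.sum_le_sum fun i _ => hq.2.2.2 i) hyQ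
      (show ∑ i, ∑ k, y i k = _ from Finset.sum_congr rfl fun i _ => hsum i)
    have hmain := convexHull_min (t := {q : ((i : Fin K) → Fin (ni i) → ℝ) × (Fin d → ℝ) |
        ((Φ fun i => ∑ k, q.1 i k • X i k), q.2) ∈ convexHull ℝ F}) ?_ ?_ hface
    · have hx : (Φ fun i => ∑ k, y i k • X i k) = x :=
        funext fun j => (congrFun (hxX (blk j)) ⟨j, hblk j⟩).symm
      simpa only [Set.mem_ofPred_eq, hx] using hmain
    · rintro ⟨y', w'⟩ ⟨⟨h01, hw, hb, hle⟩, heq⟩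
      dsimp only at h01 hw hb hle
      change ∑ i, ∑ k, y' i k = ∑ _i : Fin K, 1 at heq
      have hone : ∀ i, ∑ k, y' i k = 1 := fun i =>
        (Finset.sum_eq_sum_iff_of_le fun i _ => hle i).1 heq i (Finset.mem_univ i)
      choose k hk using fun i => exists_eq_single_of_sum_eq_one (h01 i) (hone i)
      have hpi : (fun i => X i (k i)) ∈
          convexHull ℝ (Set.univ.pi fun i => S i (k i)) := by
        rw [convexHull_pi]
        exact fun i _ => hX i (k i)
      have hgoal := convexHull_min (t := {g | (Φ g, w') ∈ convexHull ℝ F}) ?_ ?_ hpi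
      · have hsel : (fun i => ∑ k', y' i k' • X i k') = fun i => X i (k i) := by
          funext i
          simp [hk, Pi.single_apply]
        simpa only [Set.mem_ofPred_eq, hsel] using hgoal
      · intro g hg
        refine subset_convexHull ℝ _ ?_
        rw [hF]
        refine ⟨fun j => (hg (blk j) trivial).1 ⟨j, hblk j⟩, hw, fun r => ?_⟩
        refine le_trans (le_of_eq ?_) (hb r)
        dsimp only
        rw [sum_eq_sum_blocks hNdisj (fun j => ⟨blk j, hblk j⟩) fun j => Φ g j * A j r]
        congr 1
        refine Finset.sum_congr rfl fun i _ => ?_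
        simp only [hΦ, (hg i trivial).2 r, hk]
        simp [Pi.single_apply]
      · intro g hg g' hg' s t hs ht hst
        have hmem := hconv hg hg' hs ht hst
        have hw' : s • w' + t • w' = w' := by rw [← add_smul, hst, one_smul]
        rwa [Prod.smul_mk, Prod.smul_mk, Prod.mk_add_mk, hw'] at hmem
    · intro q hq q' hq' s t hs ht hst
      have hmem := hconv hq hq' hs ht hst
      have hlin : (Φ fun i => ∑ k, (s • q + t • q').1 i k • X i k) =
          s • (Φ fun i => ∑ k, q.1 i k • X i k) + t • (Φ fun i => ∑ k, q'.1 i k • X i k) := by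
        funext j
        simp [Φ, add_mul, Finset.sum_add_distrib, Finset.mul_sum, mul_assoc]
      rw [Set.mem_ofPred_eq, hlin]
      exact hmem
end

section
/- The convex hull of S equals the set of all (x,y) ∈ ℝ^n × ℝ^n satisfying: ∑_{j=1}^n x_j = ∑_{k=1}^n k·y_k; y_k ≥ 0 for all k ∈ {1,…,n}; ∑_{k=1}^n y_k ≤ 1; and, for every nonempty proper subset T ⊊ {1,…,n}, the cardinality inequality for T, namely ∑_{j∈T} x_j ≤ ∑_{k=1}^n min(k,|T|)·y_k. -/
open Finset

/-- Abel summation bound: an antitone weighting of a sequence with nonnegative prefix sums is at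
least the last weight times the total. -/
theorem Antitone.last_mul_sum_le_sum_mul (m : ℕ) (g D : Fin (m + 1) → ℝ) (hg : Antitone g)
    (hD : ∀ j, 0 ≤ ∑ i, if i ≤ j then D i else 0) :
    g (Fin.last m) * ∑ i, D i ≤ ∑ i, g i * D i := by
  induction m with
  | zero => simp
  | succ m ih =>
    have h := ih (fun i => g i.castSucc) (fun i => D i.castSucc)
      (fun a b hab => hg (Fin.castSucc_le_castSucc_iff.2 hab)) (fun j => by
        have := hD j.castSucc
        rw [Fin.sum_univ_castSucc] at this
        simpa [Fin.castSucc_le_castSucc_iff, not_le.2 (Fin.castSucc_lt_last j)] using this)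
    have hP : 0 ≤ ∑ i : Fin (m + 1), D i.castSucc := by
      have := hD (Fin.last m).castSucc
      rw [Fin.sum_univ_castSucc] at this
      simpa [Fin.castSucc_le_castSucc_iff, Fin.le_last,
        not_le.2 (Fin.castSucc_lt_last (Fin.last m))] using this
    have hlast : g (Fin.last (m + 1)) ≤ g (Fin.last m).castSucc := hg (Fin.le_last _)
    rw [Fin.sum_univ_castSucc, Fin.sum_univ_castSucc (f := fun i => g i * D i)]
    nlinarith [mul_le_mul_of_nonneg_right hlast hP]

/-- If the prefix sums of `z` are dominated by those of the tail sums of `y`, with equality in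
total, then an antitone weighting of `z` is at most the `y`-average of the prefix sums of the
weights. -/
theorem Antitone.sum_mul_le_sum_mul_sum_Iic {n : ℕ} (hn : 1 ≤ n) (g z y : Fin n → ℝ)
    (hg : Antitone g)
    (hz : ∀ j, ∑ i ∈ Iic j, z i ≤ ∑ k : Fin n, min ((k : ℕ) + 1 : ℝ) ((j : ℕ) + 1) * y k)
    (htot : ∑ i, z i = ∑ k : Fin n, ((k : ℕ) + 1 : ℝ) * y k) :
    ∑ i, g i * z i ≤ ∑ k, y k * ∑ i ∈ Iic k, g i := by
  obtain ⟨m, rfl⟩ : ∃ m, n = m + 1 := ⟨n - 1, by omega⟩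
  have hinit : ∀ j : Fin (m + 1), ∑ i ∈ Iic j, ∑ k ∈ Ici i, y k =
      ∑ k : Fin (m + 1), min ((k : ℕ) + 1 : ℝ) ((j : ℕ) + 1) * y k := by
    intro j
    rw [Finset.sum_comm' (t' := univ) (s' := fun k => Iic (min k j)) (by simp [and_comm])]
    refine sum_congr rfl fun k _ => ?_
    rw [sum_const, Fin.card_Iic, nsmul_eq_mul, min_add_add_right, Fin.coe_min]
    push_cast
    rfl
  have htail : ∑ i, ∑ k ∈ Ici i, y k = ∑ k : Fin (m + 1), ((k : ℕ) + 1 : ℝ) * y k := by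
    rw [Finset.sum_comm' (t' := univ) (s' := fun k => Iic k) (by simp)]
    refine sum_congr rfl fun k _ => ?_
    rw [sum_const, Fin.card_Iic, nsmul_eq_mul]
    push_cast
    rfl
  have hweighted : ∑ k, y k * ∑ i ∈ Iic k, g i = ∑ i, g i * ∑ k ∈ Ici i, y k := by
    simp_rw [mul_sum]
    rw [Finset.sum_comm' (t' := univ) (s' := fun i => Ici i) (by simp)]
    simp_rw [mul_comm]
  have h := Antitone.last_mul_sum_le_sum_mul m g (fun i => ∑ k ∈ Ici i, y k - z i) hg (fun j => by
    rw [← sum_filter, filter_ge_eq_Iic, sum_sub_distrib, hinit]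
    exact sub_nonneg.2 (hz j))
  simp only [mul_sub, sum_sub_distrib] at h
  rw [htail, htot, ← hweighted] at h
  linarith

/-- A linear functional on a product of coordinate spaces is determined by its coefficients. -/
theorem LinearMap.apply_prod_eq_sum {n : ℕ} (f : (Fin n → ℝ) × (Fin n → ℝ) →ₗ[ℝ] ℝ)
    (p : (Fin n → ℝ) × (Fin n → ℝ)) :
    f p = ∑ j, f (Pi.single j 1, 0) * p.1 j + ∑ k, f (0, Pi.single k 1) * p.2 k := by
  have hsplit : f p = (f ∘ₗ LinearMap.inl ℝ _ _) p.1 + (f ∘ₗ LinearMap.inr ℝ _ _) p.2 := by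
    simp [← map_add]
  rw [hsplit, LinearMap.pi_apply_eq_sum_univ (f ∘ₗ LinearMap.inl ℝ _ _),
    LinearMap.pi_apply_eq_sum_univ (f ∘ₗ LinearMap.inr ℝ _ _)]
  have hsingle : ∀ i : Fin n, (fun j => if i = j then (1 : ℝ) else 0) = Pi.single i 1 := by
    intro i
    ext j
    simp [Pi.single_apply, eq_comm]
  simp [hsingle, mul_comm]

/-- A 0/1 point of the counting set satisfies every cardinality inequality. -/
theorem sum_le_sum_min_card_mul_of_zero_one {n : ℕ} (x y : Fin n → ℝ)
    (hx : ∀ j, x j = 0 ∨ x j = 1) (hy : ∀ k, y k = 0 ∨ y k = 1)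
    (hxy : ∑ j, x j = ∑ k : Fin n, ((k : ℕ) + 1 : ℝ) * y k) (hsum : ∑ k, y k ≤ 1)
    (T : Finset (Fin n)) :
    ∑ j ∈ T, x j ≤ ∑ k : Fin n, min ((k : ℕ) + 1 : ℝ) (T.card : ℝ) * y k := by
  have hx0 : ∀ j, 0 ≤ x j := fun j => by rcases hx j with h | h <;> simp [h]
  have hx1 : ∀ j, x j ≤ 1 := fun j => by rcases hx j with h | h <;> simp [h]
  have hy0 : ∀ k, 0 ≤ y k := fun k => by rcases hy k with h | h <;> simp [h]
  have hle : ∑ j ∈ T, x j ≤ ∑ j, x j :=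
    sum_le_sum_of_subset_of_nonneg (subset_univ T) fun j _ _ => hx0 j
  by_cases hex : ∃ k, y k = 1
  · obtain ⟨k, hk⟩ := hex
    have hother : ∀ l, l ≠ k → y l = 0 := by
      have hrest := add_sum_erase univ y (mem_univ k)
      have hzero : ∑ l ∈ univ.erase k, y l = 0 :=
        le_antisymm (by linarith) (sum_nonneg fun l _ => hy0 l)
      intro l hl
      exact (sum_eq_zero_iff_of_nonneg fun l _ => hy0 l).1 hzero l (by simp [hl])
    have hval : ∀ a : Fin n → ℝ, ∑ l, a l * y l = a k := fun a => by
      rw [sum_eq_single k (fun l _ hl => by simp [hother l hl]) (by simp), hk, mul_one]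
    rw [hval] at hxy ⊢
    refine le_min (hle.trans_eq hxy) ?_
    calc ∑ j ∈ T, x j ≤ ∑ j ∈ T, (1 : ℝ) := sum_le_sum fun j _ => hx1 j
      _ = T.card := by simp
  · have hzero : ∀ k, y k = 0 := fun k => (hy k).resolve_right fun h => hex ⟨k, h⟩
    simp only [hzero, mul_zero, sum_const_zero] at hxy ⊢
    linarith

/-- The convex hull of
`S = {(x,y) ∈ {0,1}^n × {0,1}^n : ∑_j x_j = ∑_k k·y_k, ∑_k y_k ≤ 1}`
equals the set of `(x,y) ∈ ℝ^n × ℝ^n` satisfying the equation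
`∑_j x_j = ∑_k k·y_k`, nonnegativity `y_k ≥ 0`, `∑_k y_k ≤ 1`, and the
cardinality inequality `∑_{j∈T} x_j ≤ ∑_k min(k,|T|)·y_k` for every nonempty
proper subset `T ⊊ {1,…,n}`.  (Index `k : Fin n` represents the value `k+1`.) -/
theorem cardinality_counting_polytope_description (n : ℕ) (hn : 1 ≤ n) :
    convexHull ℝ
      {p : (Fin n → ℝ) × (Fin n → ℝ) |
        (∀ j, p.1 j = 0 ∨ p.1 j = 1) ∧ (∀ k, p.2 k = 0 ∨ p.2 k = 1) ∧
        (∑ j, p.1 j) = (∑ k : Fin n, ((k : ℕ) + 1 : ℝ) * p.2 k) ∧ (∑ k, p.2 k) ≤ 1} =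
    {p : (Fin n → ℝ) × (Fin n → ℝ) |
        (∑ j, p.1 j) = (∑ k : Fin n, ((k : ℕ) + 1 : ℝ) * p.2 k) ∧
        (∀ k, 0 ≤ p.2 k) ∧ (∑ k, p.2 k) ≤ 1 ∧
        ∀ T : Finset (Fin n), T.Nonempty → T ≠ Finset.univ →
          (∑ j ∈ T, p.1 j) ≤
            ∑ k : Fin n, min ((k : ℕ) + 1 : ℝ) (T.card : ℝ) * p.2 k} := by
  apply subset_antisymm
  · refine convexHull_min ?_ ?_
    · rintro ⟨x, y⟩ ⟨hx, hy, hxy, hsum⟩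
      exact ⟨hxy, fun k => (hy k).elim Eq.ge fun h => zero_le_one.trans h.ge, hsum,
        fun T _ _ => sum_le_sum_min_card_mul_of_zero_one x y hx hy hxy hsum T⟩
    · rintro ⟨x, y⟩ ⟨hxy, hy, hsum, hT⟩ ⟨x', y'⟩ ⟨hxy', hy', hsum', hT'⟩ a b ha hb hab
      have hcomb : ∀ (s : Finset (Fin n)) (v w : Fin n → ℝ),
          ∑ i ∈ s, (a * v i + b * w i) = a * ∑ i ∈ s, v i + b * ∑ i ∈ s, w i := by
        intro s v w
        rw [sum_add_distrib, mul_sum, mul_sum]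
      have hcomb_mul : ∀ c v w : Fin n → ℝ,
          ∑ i, c i * (a * v i + b * w i) = a * ∑ i, c i * v i + b * ∑ i, c i * w i := by
        intro c v w
        rw [← hcomb]
        exact sum_congr rfl fun i _ => by ring
      simp only at hxy hy hsum hT hxy' hy' hsum' hT'
      simp only [Set.mem_ofPred_eq, Prod.smul_mk, Prod.mk_add_mk, Pi.add_apply, Pi.smul_apply,
        smul_eq_mul, hcomb, hcomb_mul]
      refine ⟨by rw [hxy, hxy'], fun k => ?_, ?_, fun T h₁ h₂ => ?_⟩
      · have := hy k
        have := hy' k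
        positivity
      · nlinarith
      · exact add_le_add (mul_le_mul_of_nonneg_left (hT T h₁ h₂) ha)
          (mul_le_mul_of_nonneg_left (hT' T h₁ h₂) hb)
  · rintro ⟨x, y⟩ ⟨hxy, hy, hsum, hT⟩
    simp only at hxy hy hsum hT
    by_contra hnot
    have hfinite : {p : (Fin n → ℝ) × (Fin n → ℝ) |
        (∀ j, p.1 j = 0 ∨ p.1 j = 1) ∧ (∀ k, p.2 k = 0 ∨ p.2 k = 1) ∧
        (∑ j, p.1 j) = (∑ k : Fin n, ((k : ℕ) + 1 : ℝ) * p.2 k) ∧ (∑ k, p.2 k) ≤ 1}.Finite := by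
      have hcube : {v : Fin n → ℝ | ∀ i, v i ∈ ({0, 1} : Set ℝ)}.Finite :=
        Set.Finite.pi' fun _ => Set.toFinite _
      exact (hcube.prod hcube).subset fun p hp => ⟨hp.1, hp.2.1⟩
    obtain ⟨f, u, hfu, hup⟩ := geometric_hahn_banach_closed_point
      (convex_convexHull ℝ _) (hfinite.isClosed_convexHull ℝ) hnot
    set c : Fin n → ℝ := fun j => f (Pi.single j 1, 0)
    set d : Fin n → ℝ := fun k => f (0, Pi.single k 1)
    have hf : ∀ p, f p = ∑ j, c j * p.1 j + ∑ k, d k * p.2 k :=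
      fun p => LinearMap.apply_prod_eq_sum (f : (Fin n → ℝ) × (Fin n → ℝ) →ₗ[ℝ] ℝ) p
    set σ := Tuple.sort fun j => -c j
    have hanti : Antitone fun i => c (σ i) := fun a b hab =>
      neg_le_neg_iff.1 (Tuple.monotone_sort (fun j => -c j) hab)
    have hu : 0 < u := by
      have h := hfu 0 (subset_convexHull ℝ _ (by simp))
      simpa using h
    have hvertex : ∀ k, ∑ i ∈ Iic k, c (σ i) + d k < u := by
      intro k
      have h := hfu (fun j => if σ.symm j ≤ k then 1 else 0, Pi.single k 1)
        (subset_convexHull ℝ _ ⟨fun j => ?_, fun l => ?_, ?_, ?_⟩)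
      · rw [hf, ← Equiv.sum_comp σ] at h
        simpa [Pi.single_apply, ← sum_filter, filter_ge_eq_Iic] using h
      · by_cases hj : σ.symm j ≤ k <;> simp [hj]
      · by_cases hl : l = k <;> simp [hl]
      · rw [← Equiv.sum_comp σ]
        simp [Pi.single_apply, filter_ge_eq_Iic]
      · simp
    have hmajor := hanti.sum_mul_le_sum_mul_sum_Iic hn (fun i => c (σ i)) (fun i => x (σ i)) y
      (fun j => ?_) (by rw [Equiv.sum_comp σ x, hxy])
    · rw [Equiv.sum_comp σ fun j => c j * x j] at hmajor
      have hbound : ∑ k, y k * (∑ i ∈ Iic k, c (σ i) + d k) ≤ ∑ k, y k * u :=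
        sum_le_sum fun k _ => mul_le_mul_of_nonneg_left (hvertex k).le (hy k)
      rw [hf] at hup
      simp only [mul_add, sum_add_distrib, ← sum_mul, mul_comm (y _) (d _)] at hbound
      simp only at hup
      nlinarith
    · have hcard : ((Iic j).map σ.toEmbedding).card = (j : ℕ) + 1 := by simp
      by_cases huniv : (Iic j).map σ.toEmbedding = univ
      · have hjn : (j : ℕ) + 1 = n := by rw [← hcard, huniv, card_univ, Fintype.card_fin]
        have hx : ∑ i ∈ Iic j, x (σ i) = ∑ i, x i := by
          rw [← huniv, sum_map]
          rfl
        rw [hx, hxy]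
        refine (sum_congr rfl fun k _ => ?_).le
        rw [min_eq_left]
        have : (k : ℕ) ≤ j := by omega
        gcongr
      · have h := hT _ ⟨σ j, by simp⟩ huniv
        rw [hcard, sum_map] at h
        simpa using h
end

section
/- The convex hull of F equals the set of all x ∈ ℝ^{N_1 ∪ N_2 ∪ N_3} for which there exist y = (y^1,y^2,y^3) with y^i ∈ ℝ^{n_i} and z ∈ ℝ^p such that: y = ∑_{j=1}^p z_j · v^j; ∑_{j=1}^p z_j = 1; z_j ≥ 0 for all j; for each i ∈ {1,2,3}, ∑_{j∈N_i} x_j = ∑_{k=1}^{n_i} k·y^i_k; and for each i ∈ {1,2,3} and every nonempty proper subset T ⊊ N_i, ∑_{j∈T} x_j ≥ ∑_{k ∈ {1,…,n_i}, |T|+k > n_i} (|T| + k − n_i)·y^i_k. -/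
/-- Abel summation: weights with nonnegative tail sums, applied to a monotone sequence, give at
least their total times any lower bound of the sequence. -/
theorem mul_sum_le_sum_mul_of_monotone_of_tail_nonneg {n : ℕ} (b u : Fin n → ℝ)
    (hb : Monotone b)
    (hu : ∀ l : ℕ, 0 ≤ ∑ m : Fin n, if l ≤ (m : ℕ) then u m else 0)
    (c : ℝ) (hc : ∀ m, c ≤ b m) : c * ∑ m, u m ≤ ∑ m, b m * u m := by
  induction n generalizing c with
  | zero => simp
  | succ n ih =>
    have htail := ih (fun m => b m.succ) (fun m => u m.succ)
      (fun _ _ h => hb (Fin.succ_le_succ_iff.2 h))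
      (fun l => by simpa [Fin.sum_univ_succ] using hu (l + 1))
      (b 0) (fun m => hb (Fin.zero_le _))
    have htot : 0 ≤ ∑ m, u m := by simpa using hu 0
    have hmul := mul_le_mul_of_nonneg_right (hc 0) htot
    rw [Fin.sum_univ_succ] at hmul ⊢
    rw [Fin.sum_univ_succ]
    linarith

theorem Finset.exists_monotone_enumeration {ι : Type*} [DecidableEq ι] (s : Finset ι)
    (a : ι → ℝ) : ∃ e : Fin s.card → ι, Function.Injective e ∧
      Finset.univ.image e = s ∧ Monotone fun m => a (e m) := by
  let σ := Tuple.sort fun m => a (s.equivFin.symm m)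
  refine ⟨fun m => s.equivFin.symm (σ m),
    Subtype.val_injective.comp (s.equivFin.symm.injective.comp σ.injective), ?_,
    Tuple.monotone_sort fun m => a (s.equivFin.symm m)⟩
  ext t
  simp only [Finset.mem_image, Finset.mem_univ, true_and]
  constructor
  · rintro ⟨m, rfl⟩
    exact Subtype.property _
  · intro ht
    exact ⟨σ.symm (s.equivFin ⟨t, ht⟩), by simp⟩

theorem Fin.sum_ite_le_ite_le (n l k : ℕ) (hk : k < n) :
    (∑ m : Fin n, if l ≤ (m : ℕ) then (if (m : ℕ) < k + 1 then (1 : ℝ) else 0) else 0) =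
      if l < k + 1 then (k : ℝ) + 1 - l else 0 := by
  rw [Fin.sum_univ_eq_sum_range
    (fun m => if l ≤ m then (if m < k + 1 then (1 : ℝ) else 0) else 0)]
  simp_rw [← ite_and]
  rw [Finset.sum_boole]
  have : (Finset.range n).filter (fun m => l ≤ m ∧ m < k + 1) = Finset.Ico l (k + 1) := by
    ext m
    simp only [Finset.mem_filter, Finset.mem_range, Finset.mem_Ico]
    omega
  rw [this, Nat.card_Ico]
  split_ifs with h
  · rw [Nat.cast_sub h.le]
    push_cast
    ring
  · rw [Nat.sub_eq_zero_of_le (not_lt.1 h), Nat.cast_zero]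

/-- Greedy lower bound: over the cardinality inequalities of a block, a linear objective is at
least the `y`-average of its minima over the subsets of prescribed cardinality. -/
theorem Finset.exists_greedy_subsets {ι : Type*} [DecidableEq ι] (s : Finset ι) (a : ι → ℝ) :
    ∃ P : ℕ → Finset ι, (∀ k ≤ s.card, P k ⊆ s ∧ (P k).card = k) ∧
      ∀ (x : ι → ℝ) (y : Fin s.card → ℝ),
        (∑ j ∈ s, x j) = ∑ k : Fin s.card, ((k : ℕ) + 1 : ℝ) * y k →
        (∀ T ⊆ s, T.Nonempty → T ≠ s →
          (∑ j ∈ T, x j) ≥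
            ∑ k ∈ Finset.univ.filter (fun k : Fin s.card => s.card < T.card + ((k : ℕ) + 1)),
              ((T.card : ℝ) + ((k : ℕ) + 1) - (s.card : ℝ)) * y k) →
        ∑ k : Fin s.card, (∑ j ∈ P (k + 1), a j) * y k ≤ ∑ j ∈ s, a j * x j := by
  obtain ⟨e, he, hes, hmono⟩ := s.exists_monotone_enumeration a
  have hsum (g : ι → ℝ) : ∑ j ∈ s, g j = ∑ m, g (e m) := by
    rw [← Finset.sum_image (g := e) he.injOn, hes]
  refine ⟨fun k => (Finset.univ.filter fun m : Fin s.card => (m : ℕ) < k).image e, ?_, ?_⟩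
  · intro k hk
    refine ⟨?_, ?_⟩
    · conv_rhs => rw [← hes]
      exact Finset.image_subset_image (Finset.filter_subset _ _)
    · rw [Finset.card_image_of_injective _ he, Fin.card_filter_val_lt, min_eq_right hk]
  intro x y hx hT
  set u : Fin s.card → ℝ := fun m =>
    x (e m) - ∑ k : Fin s.card, (if (m : ℕ) < k + 1 then (1 : ℝ) else 0) * y k with hu
  have htail (l : ℕ) : (∑ m : Fin s.card, if l ≤ (m : ℕ) then u m else 0) =
      (∑ m : Fin s.card, if l ≤ (m : ℕ) then x (e m) else 0) -
        ∑ k : Fin s.card, (if l < (k : ℕ) + 1 then ((k : ℕ) : ℝ) + 1 - l else 0) * y k := by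
    simp_rw [← fun k : Fin s.card => Fin.sum_ite_le_ite_le s.card l k k.isLt, Finset.sum_mul]
    rw [Finset.sum_comm, ← Finset.sum_sub_distrib]
    refine Finset.sum_congr rfl fun m _ => ?_
    by_cases h : l ≤ (m : ℕ) <;> simp [hu, h]
  have htot : ∑ m, u m = 0 := by
    have h0 := htail 0
    simp only [Nat.zero_le, if_true, Nat.succ_pos, Nat.cast_zero, sub_zero] at h0
    rw [h0, ← hsum, hx, sub_self]
  have hpos (l : ℕ) : 0 ≤ ∑ m : Fin s.card, if l ≤ (m : ℕ) then u m else 0 := by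
    rcases Nat.eq_zero_or_pos l with rfl | hl
    · simp [htot]
    rcases le_or_gt s.card l with hle | hlt
    · refine Finset.sum_nonneg fun m _ => ?_
      rw [if_neg (by omega)]
    rw [htail, sub_nonneg]
    set T := (Finset.univ.filter fun m : Fin s.card => l ≤ (m : ℕ)).image e with hTdef
    have hcard : T.card = s.card - l := by
      rw [hTdef, Finset.card_image_of_injective _ he]
      have h1 := Finset.card_filter_add_card_filter_not (s := (Finset.univ : Finset (Fin s.card)))
        (fun m : Fin s.card => (m : ℕ) < l)
      simp only [not_lt, Fin.card_filter_val_lt, Finset.card_univ, Fintype.card_fin] at h1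
      omega
    have hTs : T ⊆ s := by
      conv_rhs => rw [← hes]
      exact Finset.image_subset_image (Finset.filter_subset _ _)
    have hcast : (T.card : ℝ) = s.card - l := by rw [hcard, Nat.cast_sub hlt.le]
    have h := hT T hTs (Finset.card_pos.1 (by omega)) (fun h => by
      have := congrArg Finset.card h
      omega)
    rw [hTdef, Finset.sum_image he.injOn, ← hTdef, Finset.sum_filter, Finset.sum_filter] at h
    refine le_trans (le_of_eq (Finset.sum_congr rfl fun k _ => ?_)) h
    by_cases hk : l < (k : ℕ) + 1
    · rw [if_pos hk, if_pos (by omega), hcast]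
      ring
    · rw [if_neg hk, if_neg (by omega), zero_mul]
  have hmain : 0 ≤ ∑ m, a (e m) * u m := by
    rcases Nat.eq_zero_or_pos s.card with h0 | h0
    · exact (Finset.sum_eq_zero fun m _ => absurd m.isLt (by omega)).ge
    · simpa [htot] using mul_sum_le_sum_mul_of_monotone_of_tail_nonneg _ u hmono hpos
        (a (e ⟨0, h0⟩)) (fun m => hmono (Fin.le_def.2 (Nat.zero_le _)))
  have hexp : ∑ m, a (e m) * u m = ∑ j ∈ s, a j * x j -
      ∑ k : Fin s.card,
        (∑ j ∈ (Finset.univ.filter fun m : Fin s.card => (m : ℕ) < k + 1).image e, a j) * y k := by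
    simp_rw [Finset.sum_image he.injOn, hsum, Finset.sum_filter, Finset.sum_mul]
    rw [Finset.sum_comm, ← Finset.sum_sub_distrib]
    refine Finset.sum_congr rfl fun m _ => ?_
    rw [hu]
    simp only [mul_sub, Finset.mul_sum]
    congr 1
    refine Finset.sum_congr rfl fun k _ => ?_
    split_ifs <;> ring
  linarith

/-- A binary vector with at most one unit entry selects a single value `K`, with `K = 0`
standing for the zero vector. -/
theorem Fin.exists_sum_mul_eq_of_binary {n : ℕ} (y : Fin n → ℝ) (hy : ∀ k, y k = 0 ∨ y k = 1)
    (hsum : ∑ k, y k ≤ 1) :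
    ∃ K ≤ n, ∀ g : ℕ → ℝ, g 0 = 0 → ∑ k : Fin n, g (k + 1) * y k = g K := by
  by_cases h : ∃ k, y k = 1
  · obtain ⟨k, hk⟩ := h
    refine ⟨k + 1, k.isLt, fun g _ => ?_⟩
    have hz (m : Fin n) (hm : m ≠ k) : y m = 0 := by
      refine (hy m).resolve_right fun h1 => ?_
      have hnn (i : Fin n) : 0 ≤ y i := by rcases hy i with h | h <;> simp [h]
      have := Finset.sum_le_sum_of_subset_of_nonneg (Finset.subset_univ {m, k})
        (fun i _ _ => hnn i)
      rw [Finset.sum_pair hm] at this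
      linarith
    rw [Finset.sum_eq_single k (fun m _ hm => by rw [hz m hm, mul_zero]) (by simp), hk, mul_one]
  · push Not at h
    refine ⟨0, Nat.zero_le _, fun g hg => ?_⟩
    rw [hg]
    exact Finset.sum_eq_zero fun k _ => by rw [(hy k).resolve_right (h k), mul_zero]

theorem Fin.sum_mul_ite_succ_eq {n K : ℕ} (hK : K ≤ n) (g : ℕ → ℝ) (hg : g 0 = 0) :
    ∑ k : Fin n, g (k + 1) * (if (k : ℕ) + 1 = K then 1 else 0) = g K := by
  rcases K with _ | K
  · simp [hg]
  · rw [Finset.sum_eq_single ⟨K, hK⟩]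
    · simp
    · intro m _ hm
      rw [if_neg, mul_zero]
      intro h
      exact hm (Fin.ext (by simpa using h))
    · simp

theorem Finset.sum_block_mul_ite_mem {ι κ : Type*} [DecidableEq ι] {N P : κ → Finset ι}
    (hN : ∀ i i', i ≠ i' → Disjoint (N i) (N i')) (hP : ∀ i, P i ⊆ N i) (h : ι → ℝ) (i : κ)
    [∀ t, Decidable (∃ i, t ∈ P i)] :
    ∑ t ∈ N i, h t * (if ∃ i, t ∈ P i then 1 else 0) = ∑ t ∈ P i, h t := by
  simp only [mul_ite, mul_one, mul_zero]
  rw [← Finset.sum_filter]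
  congr 1
  ext t
  simp only [Finset.mem_filter]
  constructor
  · rintro ⟨ht, i', ht'⟩
    rcases eq_or_ne i i' with rfl | hne
    · exact ht'
    · exact absurd (hP i' ht') (Finset.disjoint_left.1 (hN i i' hne) ht)
  · exact fun ht => ⟨hP i ht, i, ht⟩

/-- A binary vector restricted to a block counts its unit entries. -/
theorem Finset.sum_eq_card_filter_of_binary {ι : Type*} (x : ι → ℝ) (hx : ∀ j, x j = 0 ∨ x j = 1)
    (s : Finset ι) [DecidablePred fun j => x j = 1] :
    ∑ j ∈ s, x j = (s.filter fun j => x j = 1).card := by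
  rw [Finset.card_filter, Nat.cast_sum]
  refine Finset.sum_congr rfl fun j _ => ?_
  rcases hx j with h | h <;> simp [h]

/-- Complete description of the 0/1 knapsack with three distinct
coefficients in an extended space.  The ground set `ι = N_1 ∪ N_2 ∪ N_3` is
partitioned into three pairwise disjoint nonempty blocks `N i` with
`n_i = |N_i|`; the coefficients are `c 0 = μ, c 1 = λ, c 2 = σ` and the
right-hand side is `β`.  `F` is the 0/1 knapsack set, `v 1,…,v p` enumerates
(injectively and exhaustively) the vertices of the aggregated polyhedron,
i.e. the binary vectors `y = (y^1,y^2,y^3)` with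
`μ ∑_k k y^1_k + λ ∑_k k y^2_k + σ ∑_k k y^3_k ≤ β` and `∑_k y^i_k ≤ 1`.
Then `conv F` equals the set of `x ∈ ℝ^ι` for which there exist `y` and
`z ∈ ℝ^p` with `y = ∑_j z_j v^j`, `∑_j z_j = 1`, `z ≥ 0`,
`∑_{j∈N_i} x_j = ∑_k k·y^i_k`, and for every nonempty proper `T ⊊ N_i`,
`∑_{j∈T} x_j ≥ ∑_{k : |T|+k > n_i} (|T|+k-n_i)·y^i_k`.
(Index `k : Fin n_i` represents the value `k+1`.) -/
theorem knapsack_three_coefficients_extended_description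
    (ι : Type*) [Fintype ι] [DecidableEq ι]
    (N : Fin 3 → Finset ι)
    (hNne : ∀ i, (N i).Nonempty)
    (hNdisj : ∀ i i', i ≠ i' → Disjoint (N i) (N i'))
    (hNcover : ∀ j : ι, ∃ i, j ∈ N i)
    (c : Fin 3 → ℝ) (β : ℝ)
    (F : Set (ι → ℝ))
    (hF : F = {x | (∀ j, x j = 0 ∨ x j = 1) ∧
      (∑ i, c i * ∑ j ∈ N i, x j) ≤ β})
    (p : ℕ)
    (v : Fin p → ((i : Fin 3) → Fin (N i).card → ℝ))
    (hvinj : Function.Injective v)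
    (hvrange : Set.range v =
      {y : (i : Fin 3) → Fin (N i).card → ℝ |
        (∀ i k, y i k = 0 ∨ y i k = 1) ∧
        (∑ i, c i * ∑ k : Fin (N i).card, ((k : ℕ) + 1 : ℝ) * y i k) ≤ β ∧
        ∀ i, (∑ k, y i k) ≤ 1}) :
    convexHull ℝ F =
      {x : ι → ℝ |
        ∃ (y : (i : Fin 3) → Fin (N i).card → ℝ) (z : Fin p → ℝ),
          y = (∑ j, z j • v j) ∧
          (∑ j, z j) = 1 ∧
          (∀ j, 0 ≤ z j) ∧
          (∀ i, (∑ j ∈ N i, x j) =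
            ∑ k : Fin (N i).card, ((k : ℕ) + 1 : ℝ) * y i k) ∧
          ∀ i, ∀ T ⊆ N i, T.Nonempty → T ≠ N i →
            (∑ j ∈ T, x j) ≥
              ∑ k ∈ Finset.univ.filter
                  (fun k : Fin (N i).card => (N i).card < T.card + ((k : ℕ) + 1)),
                ((T.card : ℝ) + ((k : ℕ) + 1) - ((N i).card : ℝ)) * y i k} := by
  classical
  have hunion (g : ι → ℝ) : ∑ t, g t = ∑ i, ∑ t ∈ N i, g t := by
    rw [← Finset.sum_biUnion fun i _ i' _ h => hNdisj i i' h]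
    refine Finset.sum_congr ?_ fun _ _ => rfl
    ext t
    simpa using hNcover t
  apply Set.Subset.antisymm
  · refine convexHull_min ?_ ?_
    · intro x hx
      rw [hF] at hx
      obtain ⟨hbin, hle⟩ := hx
      let K : Fin 3 → ℕ := fun i => ((N i).filter fun j => x j = 1).card
      have hK (i) : K i ≤ (N i).card := Finset.card_filter_le _ _
      let y : (i : Fin 3) → Fin (N i).card → ℝ :=
        fun i k => if (k : ℕ) + 1 = K i then 1 else 0
      have hsumK (i) : ∑ k : Fin (N i).card, ((k : ℕ) + 1 : ℝ) * y i k = K i := by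
        simpa [y] using Fin.sum_mul_ite_succ_eq (hK i) (fun k => (k : ℝ)) (by simp)
      have hsumx (i) : ∑ j ∈ N i, x j = K i := Finset.sum_eq_card_filter_of_binary x hbin _
      have hy : y ∈ Set.range v := by
        rw [hvrange]
        refine ⟨fun i k => ?_, ?_, fun i => ?_⟩
        · simp only [y]
          split_ifs <;> simp
        · simpa only [hsumK, hsumx] using hle
        · have := Fin.sum_mul_ite_succ_eq (hK i) (fun k => if k = 0 then 0 else (1 : ℝ)) (by simp)
          simp only [Nat.succ_ne_zero, if_false, one_mul] at this
          simp only [y, this]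
          split_ifs <;> simp
      obtain ⟨q, hq⟩ := hy
      refine ⟨y, Pi.single q 1, ?_, ?_, ?_, ?_, ?_⟩
      · rw [Finset.sum_eq_single q (fun j _ hj => by simp [hj]) (by simp), hq]
        simp
      · simp
      · intro j
        by_cases h : j = q
        · subst h
          simp
        · simp [h]
      · intro i
        rw [hsumx, hsumK]
      · intro i T hT hne _
        have hg := Fin.sum_mul_ite_succ_eq (hK i)
          (fun k => if (N i).card < T.card + k then (T.card : ℝ) + k - (N i).card else 0)
          (by simp [Finset.card_le_card hT])
        have hrhs : ∑ k ∈ Finset.univ.filter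
              (fun k : Fin (N i).card => (N i).card < T.card + ((k : ℕ) + 1)),
              ((T.card : ℝ) + ((k : ℕ) + 1) - ((N i).card : ℝ)) * y i k =
            if (N i).card < T.card + K i then (T.card : ℝ) + K i - (N i).card else 0 := by
          rw [← hg, Finset.sum_filter]
          refine Finset.sum_congr rfl fun k _ => ?_
          rw [ite_mul, zero_mul]
          push_cast
          rfl
        rw [hrhs]
        split_ifs with h
        · have hdiff := Finset.sum_sdiff (f := x) hT
          have hone : ∑ j ∈ N i \ T, x j ≤ (N i).card - T.card := by
            have := Finset.sum_le_card_nsmul (N i \ T) x 1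
              (fun j _ => by rcases hbin j with h | h <;> simp [h])
            rw [Finset.card_sdiff_of_subset hT, nsmul_eq_mul, mul_one,
              Nat.cast_sub (Finset.card_le_card hT)] at this
            exact this
          rw [hsumx] at hdiff
          linarith
        · exact Finset.sum_nonneg fun j _ => by rcases hbin j with h | h <;> simp [h]
    · rintro x ⟨y, z, hy, hz, hz0, hxy, hxT⟩ x' ⟨y', z', hy', hz', hz0', hxy', hxT'⟩ r r' hr hr' hrr
      refine ⟨r • y + r' • y', r • z + r' • z', ?_, ?_, ?_, ?_, ?_⟩
      · rw [hy, hy', Finset.smul_sum, Finset.smul_sum, ← Finset.sum_add_distrib]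
        refine Finset.sum_congr rfl fun j _ => ?_
        simp [add_smul, mul_smul]
      · simp only [Pi.add_apply, Pi.smul_apply, smul_eq_mul]
        rw [Finset.sum_add_distrib, ← Finset.mul_sum, ← Finset.mul_sum, hz, hz']
        linarith
      · intro j
        exact add_nonneg (mul_nonneg hr (hz0 j)) (mul_nonneg hr' (hz0' j))
      · intro i
        simp only [Pi.add_apply, Pi.smul_apply, smul_eq_mul, mul_add, mul_left_comm _ r,
          mul_left_comm _ r']
        simp only [Finset.sum_add_distrib, ← Finset.mul_sum]
        rw [hxy, hxy']
      · intro i T hT hne hne'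
        simp only [Pi.add_apply, Pi.smul_apply, smul_eq_mul, mul_add, mul_left_comm _ r,
          mul_left_comm _ r']
        simp only [Finset.sum_add_distrib, ← Finset.mul_sum]
        exact add_le_add (mul_le_mul_of_nonneg_left (hxT i T hT hne hne') hr)
          (mul_le_mul_of_nonneg_left (hxT' i T hT hne hne') hr')
  · rintro x ⟨y, z, hy, hz, hz0, hxy, hxT⟩
    have hfin : F.Finite := by
      refine (Set.Finite.pi' fun _ : ι => Set.toFinite ({0, 1} : Set ℝ)).subset fun w hw => ?_
      rw [hF] at hw
      simpa using hw.1
    by_contra hx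
    obtain ⟨f, r, hfx, hfF⟩ :=
      geometric_hahn_banach_point_closed (convex_convexHull ℝ F) (hfin.isClosed_convexHull ℝ) hx
    let a : ι → ℝ := fun t => f (Pi.single t 1)
    have hf (w : ι → ℝ) : f w = ∑ t, a t * w t := by
      conv_lhs => rw [← Finset.univ_sum_single w]
      rw [map_sum]
      refine Finset.sum_congr rfl fun t _ => ?_
      have : Pi.single t (w t) = w t • (Pi.single t 1 : ι → ℝ) := by
        rw [← Pi.single_smul', smul_eq_mul, mul_one]
      rw [this, map_smul, smul_eq_mul, mul_comm]
    choose P hP hPle using fun i => (N i).exists_greedy_subsets a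
    have hv (j) : v j ∈ {y : (i : Fin 3) → Fin (N i).card → ℝ | _} := hvrange ▸ Set.mem_range_self j
    have hvertex (j : Fin p) :
        r ≤ ∑ i, ∑ k : Fin (N i).card, (∑ t ∈ P i (k + 1), a t) * v j i k := by
      obtain ⟨hbin, hle, hone⟩ := hv j
      choose K hK hKsum using fun i => Fin.exists_sum_mul_eq_of_binary (v j i) (hbin i) (hone i)
      have hblock (h : ι → ℝ) (i) := Finset.sum_block_mul_ite_mem hNdisj
        (fun i => (hP i (K i) (hK i)).1) h i
      let w : ι → ℝ := fun t => if ∃ i, t ∈ P i (K i) then 1 else 0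
      have hw : w ∈ F := by
        rw [hF]
        refine ⟨fun t => ?_, ?_⟩
        · simp only [w]
          split_ifs <;> simp
        · refine le_trans (le_of_eq (Finset.sum_congr rfl fun i _ => ?_)) hle
          have h1 := hblock (fun _ => 1) i
          have h2 := hKsum i (fun k => (k : ℝ)) (by simp)
          push_cast at h2
          simp only [one_mul, Finset.sum_const, nsmul_eq_mul, mul_one,
            (hP i (K i) (hK i)).2] at h1
          rw [h1, h2]
      refine ((hfF w (subset_convexHull ℝ F hw)).trans_eq ?_).le
      rw [hf, hunion]
      refine Finset.sum_congr rfl fun i _ => ?_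
      rw [hblock, hKsum i (fun k => ∑ t ∈ P i k, a t)]
      rw [Finset.card_eq_zero.1 (hP i 0 (Nat.zero_le _)).2, Finset.sum_empty]
    have hlower : ∑ i, ∑ k : Fin (N i).card, (∑ t ∈ P i (k + 1), a t) * y i k ≤ f x := by
      rw [hf, hunion]
      exact Finset.sum_le_sum fun i _ => hPle i x (y i) (hxy i) (hxT i)
    have havg : ∑ i, ∑ k : Fin (N i).card, (∑ t ∈ P i (k + 1), a t) * y i k =
        ∑ j, z j * ∑ i, ∑ k : Fin (N i).card, (∑ t ∈ P i (k + 1), a t) * v j i k := by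
      simp only [hy, Finset.sum_apply, Pi.smul_apply, smul_eq_mul]
      simp_rw [Finset.mul_sum (s := (Finset.univ : Finset (Fin p))),
        Finset.mul_sum (s := (Finset.univ : Finset (Fin 3)))]
      rw [Finset.sum_comm (s := (Finset.univ : Finset (Fin p)))]
      refine Finset.sum_congr rfl fun i _ => ?_
      rw [Finset.sum_comm]
      refine Finset.sum_congr rfl fun j _ => ?_
      rw [Finset.mul_sum]
      exact Finset.sum_congr rfl fun k _ => mul_left_comm _ _ _
    have hr : r ≤ ∑ j, z j * ∑ i, ∑ k : Fin (N i).card, (∑ t ∈ P i (k + 1), a t) * v j i k := by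
      calc r = ∑ j, z j * r := by rw [← Finset.sum_mul, hz, one_mul]
        _ ≤ _ := Finset.sum_le_sum fun j _ => mul_le_mul_of_nonneg_left (hvertex j) (hz0 j)
    linarith
end

section
/- The affine span over ℝ of S equals the hyperplane {(x,y) ∈ ℝ^n × ℝ^n : ∑_{j=1}^n x_j = ∑_{k=1}^n k·y_k}. -/
theorem sum_ite_le_eq_val_add_one {n : ℕ} (k : Fin n) :
    (∑ j : Fin n, if j ≤ k then (1 : ℝ) else 0) = ((k : ℕ) + 1 : ℝ) := by
  have h : Finset.univ.filter (fun j : Fin n => j ≤ k) = Finset.Iic k := by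
    ext j; simp
  rw [Finset.sum_boole, h, Fin.card_Iic]
  push_cast
  rfl

/-- A point of the hyperplane as a combination of the points `(1_{j ≤ k}, e_k)` and `(e_j, e_i)`. -/
theorem eq_sum_smul_of_sum_eq {n : ℕ} (i : Fin n) (p : (Fin n → ℝ) × (Fin n → ℝ))
    (hp : (∑ j, p.1 j) = ∑ k : Fin n, ((k : ℕ) + 1 : ℝ) * p.2 k) :
    p = (∑ k, p.2 k • ((fun j => if j ≤ k then 1 else 0, Pi.single k 1) :
          (Fin n → ℝ) × (Fin n → ℝ))) +
        ∑ j, (p.1 j - ∑ k, p.2 k * if j ≤ k then 1 else 0) •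
          ((Pi.single j 1, Pi.single i 1) : (Fin n → ℝ) × (Fin n → ℝ)) := by
  have hc : ∑ j, (p.1 j - ∑ k, p.2 k * if j ≤ k then 1 else 0) = 0 := by
    rw [Finset.sum_sub_distrib, Finset.sum_comm, hp, sub_eq_zero]
    refine Finset.sum_congr rfl fun k _ => ?_
    rw [← Finset.mul_sum, sum_ite_le_eq_val_add_one, mul_comm]
  refine Prod.ext ?_ ?_
  · ext l
    simp [Prod.fst_sum, Finset.sum_apply, Pi.single_apply]
  · rw [Prod.snd_add, Prod.snd_sum, Prod.snd_sum]
    simp only [Prod.smul_snd]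
    rw [← Finset.sum_smul, hc, zero_smul, add_zero]
    ext l
    simp [Finset.sum_apply, Pi.single_apply]

/-- The affine span over ℝ of
`S = {(x,y) ∈ {0,1}^n × {0,1}^n : ∑_j x_j = ∑_k k·y_k, ∑_k y_k ≤ 1}`
equals the hyperplane `{(x,y) ∈ ℝ^n × ℝ^n : ∑_j x_j = ∑_k k·y_k}`.
(Index `k : Fin n` represents the value `k+1`.) -/
theorem affine_span_of_cardinality_counting_set (n : ℕ) (hn : 1 ≤ n) :
    (affineSpan ℝ
      {p : (Fin n → ℝ) × (Fin n → ℝ) |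
        (∀ j, p.1 j = 0 ∨ p.1 j = 1) ∧ (∀ k, p.2 k = 0 ∨ p.2 k = 1) ∧
        (∑ j, p.1 j) = (∑ k : Fin n, ((k : ℕ) + 1 : ℝ) * p.2 k) ∧
        (∑ k, p.2 k) ≤ 1} : Set ((Fin n → ℝ) × (Fin n → ℝ))) =
    {p : (Fin n → ℝ) × (Fin n → ℝ) |
        (∑ j, p.1 j) = (∑ k : Fin n, ((k : ℕ) + 1 : ℝ) * p.2 k)} := by
  have single_zero_or_one (k l : Fin n) :
      (Pi.single k 1 : Fin n → ℝ) l = 0 ∨ (Pi.single k 1 : Fin n → ℝ) l = 1 := by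
    rw [Pi.single_apply]; split_ifs <;> simp
  set S := {p : (Fin n → ℝ) × (Fin n → ℝ) |
        (∀ j, p.1 j = 0 ∨ p.1 j = 1) ∧ (∀ k, p.2 k = 0 ∨ p.2 k = 1) ∧
        (∑ j, p.1 j) = (∑ k : Fin n, ((k : ℕ) + 1 : ℝ) * p.2 k) ∧
        (∑ k, p.2 k) ≤ 1} with hS
  have zero_mem : (0 : (Fin n → ℝ) × (Fin n → ℝ)) ∈ S := by simp [hS]
  rw [← Set.insert_eq_of_mem zero_mem, affineSpan_insert_zero]
  ext p
  refine ⟨fun h => ?_, fun h => ?_⟩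
  · refine Submodule.span_induction (fun x hx => hx.2.2.1) (by simp) ?_ ?_ h
    · intro x y _ _ hx hy
      simp only [Set.mem_ofPred_eq] at hx hy ⊢
      simp [mul_add, Finset.sum_add_distrib, hx, hy]
    · intro a x _ hx
      simp only [Set.mem_ofPred_eq] at hx ⊢
      simp [mul_left_comm _ a, ← Finset.mul_sum, hx]
  · rw [eq_sum_smul_of_sum_eq ⟨0, hn⟩ p h]
    refine Submodule.add_mem _ (Submodule.sum_mem _ fun k _ => ?_)
      (Submodule.sum_mem _ fun j _ => ?_) <;>
      refine Submodule.smul_mem _ _ (Submodule.subset_span ⟨?_, single_zero_or_one _, ?_, ?_⟩)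
    · intro j
      dsimp only
      split_ifs <;> simp
    · rw [sum_ite_le_eq_val_add_one]
      simp [Pi.single_apply]
    · simp
    · exact single_zero_or_one j
    · simp [Pi.single_apply]
    · simp
end

section
/- For every (x,y) ∈ S and every nonempty subset T ⊆ {1,…,n}, the cardinality inequality for T holds, i.e., ∑_{j∈T} x_j ≤ ∑_{k=1}^n min(k,|T|)·y_k. -/
/-- Every point `(x,y)` of
`S = {(x,y) ∈ {0,1}^n × {0,1}^n : ∑_j x_j = ∑_k k·y_k, ∑_k y_k ≤ 1}`
satisfies the cardinality inequality
`∑_{j∈T} x_j ≤ ∑_k min(k,|T|)·y_k` for every nonempty subset `T ⊆ {1,…,n}`.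
(Index `k : Fin n` represents the value `k+1`.) -/
theorem cardinality_inequality_valid (n : ℕ) (hn : 1 ≤ n)
    (x y : Fin n → ℝ)
    (hx : ∀ j, x j = 0 ∨ x j = 1) (hy : ∀ k, y k = 0 ∨ y k = 1)
    (heq : (∑ j, x j) = ∑ k : Fin n, ((k : ℕ) + 1 : ℝ) * y k)
    (hsum : (∑ k, y k) ≤ 1)
    (T : Finset (Fin n)) (hT : T.Nonempty) :
    (∑ j ∈ T, x j) ≤ ∑ k : Fin n, min ((k : ℕ) + 1 : ℝ) (T.card : ℝ) * y k := by
  have hx0 : ∀ j, 0 ≤ x j := fun j => by rcases hx j with h | h <;> simp [h]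
  have hx1 : ∀ j, x j ≤ 1 := fun j => by rcases hx j with h | h <;> simp [h]
  have hy0 : ∀ k, 0 ≤ y k := fun k => by rcases hy k with h | h <;> simp [h]
  have hle_sum : ∑ j ∈ T, x j ≤ ∑ j, x j :=
    Finset.sum_le_sum_of_subset_of_nonneg (Finset.subset_univ T) fun j _ _ => hx0 j
  have hle_card : ∑ j ∈ T, x j ≤ (T.card : ℝ) := by
    simpa using Finset.sum_le_sum fun j (_ : j ∈ T) => hx1 j
  rw [heq] at hle_sum
  by_cases hzero : ∀ k, y k = 0
  · simpa [hzero] using hle_sum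
  · push Not at hzero
    obtain ⟨k, hk⟩ := hzero
    have hk1 : y k = 1 := (hy k).resolve_left hk
    have hother : ∀ j, j ≠ k → y j = 0 := fun j hj => by
      have hpair : ∑ i ∈ {j, k}, y i ≤ ∑ i, y i :=
        Finset.sum_le_sum_of_subset_of_nonneg (Finset.subset_univ _) fun i _ _ => hy0 i
      rw [Finset.sum_pair hj] at hpair
      linarith [hy0 j]
    have hsingle : ∀ c : Fin n → ℝ, ∑ j, c j * y j = c k := fun c => by
      rw [Finset.sum_eq_single k (fun j _ hj => by simp [hother j hj]) (by simp), hk1, mul_one]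
    rw [hsingle] at hle_sum ⊢
    exact le_min hle_sum hle_card
end

section
/- Let c, d ∈ ℝ^n with c_1 ≥ c_2 ≥ … ≥ c_n. If ∑_{j=1}^n c_j x_j + ∑_{k=1}^n d_k y_k ≤ 0 holds for all (x,y) ∈ S, then for every k ∈ {1,…,n} one has d_k ≤ −(c_1 + c_2 + ⋯ + c_k). -/
/-- Let `c, d ∈ ℝ^n` with `c_1 ≥ c_2 ≥ … ≥ c_n`.  If the
inequality `∑_j c_j x_j + ∑_k d_k y_k ≤ 0` is valid for all `(x,y)` in
`S = {(x,y) ∈ {0,1}^n × {0,1}^n : ∑_j x_j = ∑_k k·y_k, ∑_k y_k ≤ 1}`,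
then for every `k ∈ {1,…,n}` one has `d_k ≤ -(c_1 + ⋯ + c_k)`.
(Index `k : Fin n` represents the value `k+1`; `c_1 + ⋯ + c_k` becomes the
sum of `c j` over all `j ≤ k`.) -/
theorem valid_inequality_y_coefficient_bound (n : ℕ) (hn : 1 ≤ n)
    (c d : Fin n → ℝ)
    (hc : ∀ i j : Fin n, i ≤ j → c j ≤ c i)
    (hvalid : ∀ x y : Fin n → ℝ,
      (∀ j, x j = 0 ∨ x j = 1) → (∀ k, y k = 0 ∨ y k = 1) →
      ((∑ j, x j) = ∑ k : Fin n, ((k : ℕ) + 1 : ℝ) * y k) →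
      ((∑ k, y k) ≤ 1) →
      (∑ j, c j * x j) + (∑ k, d k * y k) ≤ 0) :
    ∀ k : Fin n,
      d k ≤ -(∑ j ∈ Finset.univ.filter (fun j : Fin n => j ≤ k), c j) := by
  intro k
  have h := hvalid (fun j => if j ≤ k then 1 else 0) (fun j => if j = k then 1 else 0)
    (fun j => by by_cases hj : j ≤ k <;> simp [hj])
    (fun j => by by_cases hj : j = k <;> simp [hj])
    (by
      have hcard : (Finset.univ.filter (fun j : Fin n => j ≤ k)).card = (k : ℕ) + 1 := by
        rw [Finset.filter_ge_eq_Iic, Fin.card_Iic]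
      rw [Finset.sum_boole, hcard]
      simp)
    (by simp)
  simp only [mul_ite, mul_one, mul_zero, Finset.sum_ite_eq', Finset.mem_univ, if_true,
    ← Finset.sum_filter] at h
  linarith
end

section
/- Let c ∈ ℝ^n with c_1 ≥ c_2 ≥ … ≥ c_n ≥ 0. Let (x,y) ∈ ℝ^n × ℝ^n with y_k ≥ 0 for all k, and suppose the cardinality inequality holds for every initial segment T = {1,…,t}, t ∈ {1,…,n}, i.e., ∑_{i=1}^t x_i ≤ ∑_{k=1}^n min(k,t)·y_k for all t. Then ∑_{j=1}^n c_j x_j ≤ ∑_{k=1}^n (c_1 + c_2 + ⋯ + c_k)·y_k. -/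
/-- Abel inequality: a weighted sum with antitone weights bounded below by `b` is at least
`b` times the unweighted sum, provided all partial sums are nonnegative. -/
lemma mul_sum_le_sum_mul_of_antitone {n : ℕ} {c w : Fin n → ℝ} (hc : Antitone c)
    (hw : ∀ t ≤ n, 0 ≤ ∑ i with (i : Fin n).val < t, w i) {b : ℝ} (hb : ∀ j, b ≤ c j) :
    b * ∑ j, w j ≤ ∑ j, c j * w j := by
  induction n generalizing b with
  | zero => simp
  | succ n ih =>
    have init := ih (c := fun i => c i.castSucc) (w := fun i => w i.castSucc)
      (fun i j hij => hc (Fin.castSucc_le_castSucc_iff.2 hij))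
      (fun t ht => by
        simpa [Finset.sum_filter, Fin.sum_univ_castSucc, ht.not_gt] using hw t (by omega))
      (b := c (Fin.last n)) (fun j => hc (Fin.le_last _))
    have total : 0 ≤ ∑ j, w j := by
      simpa only [Fin.is_lt, Finset.filter_true] using hw (n + 1) le_rfl
    refine (mul_le_mul_of_nonneg_right (hb (Fin.last n)) total).trans ?_
    rw [Fin.sum_univ_castSucc, Fin.sum_univ_castSucc, mul_add]
    gcongr

lemma card_filter_lt_and_le {n : ℕ} (k : Fin n) (t : ℕ) :
    (Finset.univ.filter fun j : Fin n => j.val < t ∧ j ≤ k).card = min (k.val + 1) t := by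
  have hmap : (Finset.univ.filter fun j : Fin n => j.val < t ∧ j ≤ k).map Fin.valEmbedding
      = Finset.range (min (k.val + 1) t) := by
    ext a
    simp only [Finset.mem_map, Finset.mem_filter, Finset.mem_univ, true_and,
      Fin.valEmbedding_apply, Finset.mem_range, lt_min_iff, Fin.le_def]
    constructor
    · rintro ⟨j, hj, rfl⟩
      omega
    · intro ha
      exact ⟨⟨a, by omega⟩, ⟨ha.2, by simp only; omega⟩, rfl⟩
  rw [← Finset.card_map Fin.valEmbedding, hmap, Finset.card_range]

/-- The partial sums of the tail sums of `y` are the right-hand sides of the cardinality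
inequalities. -/
lemma sum_tail_sums {n : ℕ} (y : Fin n → ℝ) (t : ℕ) :
    ∑ j with (j : Fin n).val < t, ∑ k with j ≤ k, y k
      = ∑ k : Fin n, min ((k : ℕ) + 1 : ℝ) (t : ℝ) * y k := by
  simp_rw [Finset.sum_filter (fun k => _ ≤ k)]
  rw [Finset.sum_comm]
  refine Finset.sum_congr rfl fun k _ => ?_
  rw [← Finset.sum_filter, Finset.filter_filter, Finset.sum_const, card_filter_lt_and_le,
    nsmul_eq_mul]
  push_cast
  rfl

/-- Let `c ∈ ℝ^n` with `c_1 ≥ c_2 ≥ … ≥ c_n ≥ 0`.  Let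
`(x,y) ∈ ℝ^n × ℝ^n` with `y ≥ 0` satisfying the cardinality inequality
`∑_{i=1}^t x_i ≤ ∑_k min(k,t)·y_k` for every initial segment `{1,…,t}`,
`t ∈ {1,…,n}`.  Then `∑_j c_j x_j ≤ ∑_k (c_1 + ⋯ + c_k)·y_k`.
(Index `k : Fin n` represents the value `k+1`.) -/
theorem conic_combination_initial_segments (n : ℕ) (hn : 1 ≤ n)
    (c : Fin n → ℝ)
    (hc : ∀ i j : Fin n, i ≤ j → c j ≤ c i)
    (hcnn : ∀ j, 0 ≤ c j)
    (x y : Fin n → ℝ) (hy : ∀ k, 0 ≤ y k)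
    (hcard : ∀ t : ℕ, 1 ≤ t → t ≤ n →
      (∑ i ∈ Finset.univ.filter (fun i : Fin n => (i : ℕ) < t), x i) ≤
        ∑ k : Fin n, min ((k : ℕ) + 1 : ℝ) (t : ℝ) * y k) :
    (∑ j, c j * x j) ≤
      ∑ k : Fin n,
        (∑ j ∈ Finset.univ.filter (fun j : Fin n => j ≤ k), c j) * y k := by
  have rhs : ∑ k : Fin n, (∑ j with j ≤ k, c j) * y k = ∑ j, c j * ∑ k with j ≤ k, y k := by
    simp_rw [Finset.sum_mul, Finset.mul_sum, Finset.sum_filter]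
    exact Finset.sum_comm
  have key := mul_sum_le_sum_mul_of_antitone (w := fun j => (∑ k with j ≤ k, y k) - x j)
    (fun i j hij => hc i j hij) (fun t ht => ?_) hcnn
  · simp only [zero_mul, mul_sub, Finset.sum_sub_distrib] at key
    linarith
  · rw [Finset.sum_sub_distrib, sum_tail_sums, sub_nonneg]
    rcases Nat.eq_zero_or_pos t with rfl | hpos
    · simpa using Finset.sum_nonneg fun k _ =>
        mul_nonneg (le_min (by positivity) le_rfl) (hy k)
    · exact hcard t hpos ht
end

section
/- Let c, d ∈ ℝ^n with c_1 ≥ c_2 ≥ … ≥ c_n ≥ 0, and suppose ∑_{j=1}^n c_j x_j + ∑_{k=1}^n d_k y_k ≤ 0 holds for all (x,y) ∈ S. Then for every (x,y) ∈ ℝ^n × ℝ^n with y_k ≥ 0 for all k that satisfies the cardinality inequality for every initial segment T = {1,…,t}, t ∈ {1,…,n}, one has ∑_{j=1}^n c_j x_j + ∑_{k=1}^n d_k y_k ≤ 0. -/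
/-- Abel summation: if all partial sums of `w` are nonpositive, then so is the sum of `w` weighted
by a nonnegative antitone `c`. -/
theorem sum_mul_nonpos_of_partial_sums_nonpos {n : ℕ} {c w : Fin n → ℝ} (hc : Antitone c)
    (hc0 : ∀ j, 0 ≤ c j) (hw : ∀ t ≤ n, ∑ i : Fin n, (if (i : ℕ) < t then w i else 0) ≤ 0) :
    ∑ j, c j * w j ≤ 0 := by
  induction n with
  | zero => simp
  | succ n ih =>
    have hinit : ∑ j : Fin n, (c j.castSucc - c (Fin.last n)) * w j.castSucc ≤ 0 := by
      refine ih (c := fun j => c j.castSucc - c (Fin.last n)) (w := fun j => w j.castSucc)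
        (fun i j hij => ?_) (fun j => ?_) fun t ht => ?_
      · exact sub_le_sub_right (hc (Fin.castSucc_le_castSucc_iff.mpr hij)) _
      · exact sub_nonneg.mpr (hc (Fin.le_last _))
      · simpa [Fin.sum_univ_castSucc, Nat.not_lt.mpr ht] using hw t (by omega)
    have htotal : ∑ j, w j ≤ 0 := by simpa [Fin.is_le] using hw (n + 1) le_rfl
    have hdecomp : ∑ j, c j * w j
        = ∑ j : Fin n, (c j.castSucc - c (Fin.last n)) * w j.castSucc
          + c (Fin.last n) * ∑ j, w j := by
      simp only [Fin.sum_univ_castSucc, sub_mul, Finset.sum_sub_distrib, ← Finset.mul_sum]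
      ring
    have := mul_nonpos_of_nonneg_of_nonpos (hc0 (Fin.last n)) htotal
    linarith

/-- The number of indices `i ≤ k` with `i < t` is `min (k + 1) t`. -/
theorem sum_ite_lt_ite_le {n : ℕ} (k : Fin n) (t : ℕ) :
    ∑ i : Fin n, (if (i : ℕ) < t then (if i ≤ k then (1 : ℝ) else 0) else 0)
      = min ((k : ℕ) + 1 : ℝ) (t : ℝ) := by
  have hk := k.isLt
  have hfilter : (Finset.range n).filter (fun i => i < t ∧ i ≤ (k : ℕ))
      = Finset.range (min ((k : ℕ) + 1) t) := by
    ext i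
    simp only [Finset.mem_filter, Finset.mem_range]
    omega
  simp only [← ite_and, Fin.le_def]
  rw [Fin.sum_univ_eq_sum_range (fun i => if i < t ∧ i ≤ (k : ℕ) then (1 : ℝ) else 0) n,
    Finset.sum_boole, hfilter]
  simp

/-- Let `c, d ∈ ℝ^n` with `c_1 ≥ c_2 ≥ … ≥ c_n ≥ 0`, and suppose
`∑_j c_j x_j + ∑_k d_k y_k ≤ 0` holds for all `(x,y)` in
`S = {(x,y) ∈ {0,1}^n × {0,1}^n : ∑_j x_j = ∑_k k·y_k, ∑_k y_k ≤ 1}`.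
Then every `(x,y) ∈ ℝ^n × ℝ^n` with `y ≥ 0` that satisfies the cardinality
inequality for every initial segment `{1,…,t}`, `t ∈ {1,…,n}`, also satisfies
`∑_j c_j x_j + ∑_k d_k y_k ≤ 0`.
(Index `k : Fin n` represents the value `k+1`.) -/
theorem valid_inequality_dominated_by_initial_segments (n : ℕ) (hn : 1 ≤ n)
    (c d : Fin n → ℝ)
    (hc : ∀ i j : Fin n, i ≤ j → c j ≤ c i)
    (hcnn : ∀ j, 0 ≤ c j)
    (hvalid : ∀ x y : Fin n → ℝ,
      (∀ j, x j = 0 ∨ x j = 1) → (∀ k, y k = 0 ∨ y k = 1) →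
      ((∑ j, x j) = ∑ k : Fin n, ((k : ℕ) + 1 : ℝ) * y k) →
      ((∑ k, y k) ≤ 1) →
      (∑ j, c j * x j) + (∑ k, d k * y k) ≤ 0) :
    ∀ x y : Fin n → ℝ, (∀ k, 0 ≤ y k) →
      (∀ t : ℕ, 1 ≤ t → t ≤ n →
        (∑ i ∈ Finset.univ.filter (fun i : Fin n => (i : ℕ) < t), x i) ≤
          ∑ k : Fin n, min ((k : ℕ) + 1 : ℝ) (t : ℝ) * y k) →
      (∑ j, c j * x j) + (∑ k, d k * y k) ≤ 0 := by
  intro x y hy hcard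
  have hd : ∀ k, (∑ j, c j * (if j ≤ k then 1 else 0)) + d k ≤ 0 := by
    intro k
    have h := hvalid (fun j => if j ≤ k then 1 else 0) (Pi.single k 1)
      (fun j => by by_cases hj : j ≤ k <;> simp [hj])
      (fun j => by by_cases hj : j = k <;> simp [hj])
      (by
        have hcount := sum_ite_lt_ite_le k n
        have hk : ((k : ℕ) + 1 : ℝ) ≤ n := by exact_mod_cast k.isLt
        simpa [Pi.single_apply, min_eq_left hk] using hcount)
      (by simp)
    simpa [Pi.single_apply] using h
  have habel : ∑ j, c j * (x j - ∑ k, (if j ≤ k then 1 else 0) * y k) ≤ 0 := by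
    refine sum_mul_nonpos_of_partial_sums_nonpos hc hcnn fun t ht => ?_
    rcases Nat.eq_zero_or_pos t with rfl | ht0
    · simp
    have hswap : ∑ i : Fin n, (if (i : ℕ) < t then ∑ k, (if i ≤ k then 1 else 0) * y k else 0)
        = ∑ k : Fin n, min ((k : ℕ) + 1 : ℝ) (t : ℝ) * y k := by
      simp only [← sum_ite_lt_ite_le, Finset.sum_mul]
      rw [Finset.sum_comm]
      refine Finset.sum_congr rfl fun i _ => ?_
      split_ifs <;> simp
    have h := hcard t ht0 ht
    rw [← hswap, Finset.sum_filter, ← sub_nonpos, ← Finset.sum_sub_distrib] at h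
    refine le_trans (le_of_eq (Finset.sum_congr rfl fun i _ => ?_)) h
    split_ifs <;> simp
  have hcover : ∑ j, c j * ∑ k, (if j ≤ k then 1 else 0) * y k
      = ∑ k, (∑ j, c j * (if j ≤ k then 1 else 0)) * y k := by
    simp only [Finset.mul_sum, Finset.sum_mul, mul_assoc]
    exact Finset.sum_comm
  have hsum : ∑ k, ((∑ j, c j * (if j ≤ k then 1 else 0)) + d k) * y k ≤ 0 :=
    Finset.sum_nonpos fun k _ => mul_nonpos_of_nonpos_of_nonneg (hd k) (hy k)
  simp only [mul_sub, Finset.sum_sub_distrib] at habel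
  simp only [add_mul, Finset.sum_add_distrib] at hsum
  linarith
end

section
/- Validity of the value-disjunction extended formulation: a point (x,w) ∈ ℤ^n × ℝ^d belongs to F if and only if there exists y = (y^1,…,y^K) ∈ {0,1}^{n_1+⋯+n_K} such that: for every i ∈ {1,…,K}, 0 ≤ x_j ≤ u_j for all j ∈ N_i, ∑_{j∈N_i} A_j x_j = ∑_{k=1}^{n_i} f^i_k y^i_k, and ∑_{k=1}^{n_i} y^i_k = 1; and moreover w ≥ 0 and ∑_{i=1}^K ∑_{k=1}^{n_i} f^i_k y^i_k + ∑_{j=1}^d G_j w_j ≤ b. -/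
/-- Validity of the value-disjunction extended formulation.
A point `(x,w) ∈ ℤ^n × ℝ^d` belongs to the mixed-integer set `F` if and only
if there exists a binary vector `y = (y^1,…,y^K)` such that for every block
`i`: `0 ≤ x_j ≤ u_j` on `N_i`, `∑_{j∈N_i} A_j x_j = ∑_k f^i_k y^i_k`, and
`∑_k y^i_k = 1`; and moreover `w ≥ 0` and
`∑_i ∑_k f^i_k y^i_k + ∑_j G_j w_j ≤ b`. -/
theorem value_disjunction_extended_formulation_validity
    (m n d K : ℕ) (hm : 0 < m) (hn : 0 < n) (hd : 0 < d) (hK : 0 < K)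
    (A : Fin n → Fin m → ℝ) (G : Fin d → Fin m → ℝ) (b : Fin m → ℝ)
    (u : Fin n → ℤ) (hu : ∀ j, 0 ≤ u j)
    (N : Fin K → Finset (Fin n))
    (hNne : ∀ i, (N i).Nonempty)
    (hNdisj : ∀ i i', i ≠ i' → Disjoint (N i) (N i'))
    (hNcover : ∀ j : Fin n, ∃ i, j ∈ N i)
    (ni : Fin K → ℕ)
    (f : (i : Fin K) → Fin (ni i) → Fin m → ℝ)
    (hfinj : ∀ i, Function.Injective (f i))
    (hfrange : ∀ i, Set.range (f i) =
      {v : Fin m → ℝ | ∃ x : Fin n → ℤ,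
        (∀ j ∈ N i, 0 ≤ x j ∧ x j ≤ u j) ∧
        ∀ r, v r = ∑ j ∈ N i, (x j : ℝ) * A j r})
    (x : Fin n → ℤ) (w : Fin d → ℝ) :
    ((∀ j, 0 ≤ x j ∧ x j ≤ u j) ∧ (∀ j, 0 ≤ w j) ∧
      ∀ r, (∑ j, (x j : ℝ) * A j r) + (∑ j, w j * G j r) ≤ b r) ↔
    (∃ y : (i : Fin K) → Fin (ni i) → ℝ,
      (∀ i k, y i k = 0 ∨ y i k = 1) ∧
      (∀ i, (∀ j ∈ N i, 0 ≤ x j ∧ x j ≤ u j) ∧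
        (∀ r, (∑ j ∈ N i, (x j : ℝ) * A j r) = ∑ k, y i k * f i k r) ∧
        (∑ k, y i k) = 1) ∧
      (∀ j, 0 ≤ w j) ∧
      ∀ r, (∑ i, ∑ k, y i k * f i k r) + (∑ j, w j * G j r) ≤ b r) := by
  have hsum (g : Fin n → ℝ) : ∑ j, g j = ∑ i, ∑ j ∈ N i, g j := by
    rw [← Finset.sum_biUnion fun i _ i' _ h => hNdisj i i' h]
    congr 1
    ext j
    simpa using hNcover j
  constructor
  · rintro ⟨hx, hw, hb⟩
    have hvalue (i : Fin K) : ∃ k, f i k = fun r => ∑ j ∈ N i, (x j : ℝ) * A j r :=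
      (hfrange i).ge ⟨x, fun j _ => hx j, fun _ => rfl⟩
    choose k hk using hvalue
    have hy (i : Fin K) (r : Fin m) :
        ∑ l, (Pi.single (k i) 1 : Fin (ni i) → ℝ) l * f i l r =
          ∑ j ∈ N i, (x j : ℝ) * A j r := by
      simp [Pi.single_apply, hk]
    refine ⟨fun i => Pi.single (k i) 1, fun i l => ?_,
      fun i => ⟨fun j _ => hx j, fun r => (hy i r).symm, by simp⟩, hw, fun r => ?_⟩
    · by_cases h : l = k i <;> simp [h]
    · simpa only [hy, ← hsum] using hb r
  · rintro ⟨y, -, hblock, hw, hb⟩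
    refine ⟨fun j => ?_, hw, fun r => ?_⟩
    · obtain ⟨i, hi⟩ := hNcover j
      exact (hblock i).1 j hi
    · rw [hsum, Finset.sum_congr rfl fun i _ => (hblock i).2.1 r]
      exact hb r
end
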